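/- Fix τ > 0 and x ∈ ℝ, let ι : ℝ → (0, ∞) be differentiable at k₀ = x, and define the price curve v(k) = Bac(τ, x, k, ι(k)). Then the at-the-money implied-volatility skew satisfies ι′(x) = ( v′(x) + 1/2 )·√(2π)/√τ; in particular, ∂Bac/∂k evaluated at the money (k = x) equals −1/2 and the at-the-money vega ∂Bac/∂σ at k = x equals √τ/√(2π). -/

import Mathlib

open MeasureTheory Filter Set

/-- Standard normal density `φ(z) = e^{-z²/2}/√(2π)`. -/
noncomputable def stdGaussPdf (z : ℝ) : ℝ := Real.exp (-(z ^ 2) / 2) / Real.sqrt (2 * Real.pi)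

/-- Standard normal cumulative distribution function `Φ(z) = ∫_{-∞}^z φ(u) du`. -/
noncomputable def stdGaussCdf (z : ℝ) : ℝ := ∫ u in Set.Iic z, stdGaussPdf u

/-- `d(x, k, σ, τ) = (x − k)/(σ√τ)`. -/
noncomputable def dBac (x k σ τ : ℝ) : ℝ := (x - k) / (σ * Real.sqrt τ)

/-- Bachelier price `Bac(τ, x, k, σ) = (x − k)·Φ(d) + φ(d)·σ·√τ`. -/
noncomputable def Bac (τ x k σ : ℝ) : ℝ :=
  (x - k) * stdGaussCdf (dBac x k σ τ) + stdGaussPdf (dBac x k σ τ) * σ * Real.sqrt τ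

lemma stdGaussPdf_continuous : Continuous stdGaussPdf := by
  unfold stdGaussPdf
  fun_prop

lemma stdGaussPdf_integrable : Integrable stdGaussPdf := by
  have h := (integrable_exp_neg_mul_sq (b := 1 / 2) (by norm_num)).div_const
    (Real.sqrt (2 * Real.pi))
  refine h.congr (Eventually.of_forall fun z => ?_)
  simp only [stdGaussPdf]
  congr 2
  ring

lemma stdGaussCdf_zero : stdGaussCdf 0 = 1 / 2 := by
  have h1 : stdGaussCdf 0 = ∫ u in Set.Ioi (0 : ℝ), stdGaussPdf u := by
    have h := integral_comp_neg_Iic (0 : ℝ) stdGaussPdf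
    rw [neg_zero] at h
    rw [← h]
    simp [stdGaussCdf, stdGaussPdf]
  have h2 : ∀ u, stdGaussPdf u = Real.exp (-(1 / 2) * u ^ 2) / Real.sqrt (2 * Real.pi) := by
    intro u
    simp only [stdGaussPdf]
    congr 2
    ring
  rw [h1]
  simp_rw [h2]
  rw [integral_div, integral_gaussian_Ioi]
  have h3 : Real.pi / (1 / 2) = 2 * Real.pi := by ring
  rw [h3]
  have h4 : Real.sqrt (2 * Real.pi) ≠ 0 := by positivity
  field_simp

lemma stdGaussCdf_hasDerivAt (z : ℝ) : HasDerivAt stdGaussCdf (stdGaussPdf z) z := by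
  have h : stdGaussCdf = fun y => stdGaussCdf 0 + ∫ u in (0 : ℝ)..y, stdGaussPdf u := by
    funext y
    have := intervalIntegral.integral_Iic_sub_Iic (μ := volume) (f := stdGaussPdf) (a := 0)
      (b := y) stdGaussPdf_integrable.integrableOn stdGaussPdf_integrable.integrableOn
    rw [← this]
    simp [stdGaussCdf]
  rw [h]
  exact (stdGaussPdf_continuous.integral_hasStrictDerivAt 0 z).hasDerivAt.const_add _

lemma stdGaussPdf_hasDerivAt (z : ℝ) : HasDerivAt stdGaussPdf (-z * stdGaussPdf z) z := by
  have h := ((((hasDerivAt_id z).pow 2).neg.div_const 2).exp).div_const (Real.sqrt (2 * Real.pi))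
  refine h.congr_deriv ?_
  simp [stdGaussPdf]
  ring

lemma Bac_curve_hasDerivAt (τ x : ℝ) (hτ : 0 < τ) (ι : ℝ → ℝ) (i : ℝ) (hpos : 0 < ι x)
    (hι : HasDerivAt ι i x) :
    HasDerivAt (fun k => Bac τ x k (ι k))
      (-(1 / 2) + i * (Real.sqrt τ / Real.sqrt (2 * Real.pi))) x := by
  have hs : 0 < Real.sqrt τ := Real.sqrt_pos.2 hτ
  have hl : HasDerivAt (fun k => x - k) (-1) x := by
    simpa using (hasDerivAt_id x).const_sub x
  have hd := hl.div (hι.mul_const (Real.sqrt τ)) (by positivity)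
  have hd0 : dBac x x (ι x) τ = 0 := by simp [dBac]
  have hd' : HasDerivAt (fun k => dBac x k (ι k) τ) _ x := hd
  have hc := (stdGaussCdf_hasDerivAt (dBac x x (ι x) τ)).comp x hd'
  have hp := (stdGaussPdf_hasDerivAt (dBac x x (ι x) τ)).comp x hd'
  have := (hl.mul hc).add ((hp.mul hι).mul_const (Real.sqrt τ))
  refine this.congr_deriv ?_
  simp [hd0, stdGaussCdf_zero]
  simp [stdGaussPdf]
  ring

/-- Fix τ > 0 and x ∈ ℝ; let ι be a positive implied-volatility
curve differentiable at k₀ = x, and set `v(k) = Bac(τ, x, k, ι(k))`. Then the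
at-the-money skew satisfies `ι′(x) = (v′(x) + 1/2)·√(2π)/√τ`; in particular, for
any σ > 0 the strike derivative of `Bac` at the money equals −1/2 and the
at-the-money vega equals `√τ/√(2π)`. -/
theorem implied_vol_atm_skew (τ x : ℝ) (hτ : 0 < τ)
    (ι : ℝ → ℝ) (hιpos : ∀ k, 0 < ι k) (hι : DifferentiableAt ℝ ι x) :
    deriv ι x
      = (deriv (fun k => Bac τ x k (ι k)) x + 1 / 2) * Real.sqrt (2 * Real.pi) / Real.sqrt τ ∧
    ∀ σ : ℝ, 0 < σ →
      deriv (fun k => Bac τ x k σ) x = -(1 / 2) ∧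
      deriv (fun s => Bac τ x x s) σ = Real.sqrt τ / Real.sqrt (2 * Real.pi) := by
  have h2 : Real.sqrt (2 * Real.pi) ≠ 0 := by positivity
  have hs : Real.sqrt τ ≠ 0 := by positivity
  refine ⟨?_, fun σ hσ => ⟨?_, ?_⟩⟩
  · rw [(Bac_curve_hasDerivAt τ x hτ ι _ (hιpos x) hι.hasDerivAt).deriv]
    field_simp
    ring
  · rw [(Bac_curve_hasDerivAt τ x hτ (fun _ => σ) 0 hσ (hasDerivAt_const x σ)).deriv]
    ring
  · have h : (fun s => Bac τ x x s) =
        fun s => s * (Real.sqrt τ / Real.sqrt (2 * Real.pi)) := by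
      funext s
      simp [Bac, dBac, stdGaussPdf]
      ring
    rw [h]
    simpa using ((hasDerivAt_id σ).mul_const (Real.sqrt τ / Real.sqrt (2 * Real.pi))).deriv
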